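/- For every K ≥ 1 and every p with 1 ≤ p ≤ ∞ there is a constant C ≥ 1, depending only on K and p, with the following property. Let (J, ≤) be a partially ordered set and let (X_j)_{j ∈ J} be a family of real Banach spaces such that X_i is K-complemented in X_j whenever i ≤ j. Let φ₁, φ₂ : ℕ → J be maps such that for every j ∈ J and every m ∈ ℕ there exists n ≥ m with j ≤ φ_i(n) (for i = 1 and i = 2). Set Y_i = (⊕_{n ∈ ℕ} X_{φ_i(n)})_p for i = 1, 2. Then Y₁ is C-isomorphic to Y₂, and Y₁ is C-isomorphic to (⊕_{n ∈ ℕ} Y₁)_p. -/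

import Mathlib

open scoped ENNReal

/-- A normed space `X` is `K`-complemented in `Y` if there are bounded linear operators
`S : X → Y` and `T : Y → X` with `T ∘ S = Id_X` and `‖S‖·‖T‖ ≤ K`. -/
def IsComplementedIn (K : ℝ) (X Y : Type*)
    [NormedAddCommGroup X] [NormedSpace ℝ X] [NormedAddCommGroup Y] [NormedSpace ℝ Y] : Prop :=
  ∃ (S : X →L[ℝ] Y) (T : Y →L[ℝ] X), (∀ x : X, T (S x) = x) ∧ ‖S‖ * ‖T‖ ≤ K

/-- Normed spaces `X` and `Y` are `C`-isomorphic if there are bounded linear operators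
`S : X → Y` and `T : Y → X` with `T ∘ S = Id_X`, `S ∘ T = Id_Y` and `‖S‖·‖T‖ ≤ C`. -/
def IsCIsomorphic (C : ℝ) (X Y : Type*)
    [NormedAddCommGroup X] [NormedSpace ℝ X] [NormedAddCommGroup Y] [NormedSpace ℝ Y] : Prop :=
  ∃ (S : X →L[ℝ] Y) (T : Y →L[ℝ] X),
    (∀ x : X, T (S x) = x) ∧ (∀ y : Y, S (T y) = y) ∧ ‖S‖ * ‖T‖ ≤ C


lemma aux_crit {p : ℝ≥0∞} [Fact (1 ≤ p)] {κ : Type} {F : κ → Type}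
    [∀ j, NormedAddCommGroup (F j)] (g : ∀ j, F j) (C : ℝ) (hC : 0 ≤ C)
    (h1 : p = ∞ → ∀ j, ‖g j‖ ≤ C)
    (h2 : p ≠ ∞ → 0 < p.toReal →
      ∀ s : Finset κ, ∑ j ∈ s, ‖g j‖ ^ p.toReal ≤ C ^ p.toReal) :
    ∃ h : Memℓp g p, ‖(⟨g, h⟩ : lp F p)‖ ≤ C := by
  by_cases hp : p = ∞
  · subst hp
    have hm : Memℓp g ∞ := memℓp_infty ⟨C, by rintro _ ⟨j, rfl⟩; exact h1 rfl j⟩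
    exact ⟨hm, lp.norm_le_of_forall_le hC (fun j => h1 rfl j)⟩
  · have hp0 : 0 < p.toReal :=
      ENNReal.toReal_pos (zero_lt_one.trans_le (Fact.out : 1 ≤ p)).ne' hp
    have hm : Memℓp g p := memℓp_gen' (C := C ^ p.toReal) (h2 hp hp0)
    exact ⟨hm, lp.norm_le_of_forall_sum_le hp0 hC (h2 hp hp0)⟩

lemma aux_mk {p : ℝ≥0∞} [Fact (1 ≤ p)] {V : Type} [NormedAddCommGroup V] [NormedSpace ℝ V]
    {κ : Type} {F : κ → Type}
    [∀ j, NormedAddCommGroup (F j)] [∀ j, NormedSpace ℝ (F j)]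
    (A : V →ₗ[ℝ] (∀ j, F j)) (c : ℝ) (hc : 0 ≤ c)
    (h : ∀ v, ∃ h : Memℓp (A v) p, ‖(⟨A v, h⟩ : lp F p)‖ ≤ c * ‖v‖) :
    ∃ Φ : V →L[ℝ] lp F p, ‖Φ‖ ≤ c ∧ ∀ v j, (Φ v : ∀ j, F j) j = A v j := by
  choose hm hn using h
  let L : V →ₗ[ℝ] lp F p :=
    { toFun := fun v => ⟨A v, hm v⟩
      map_add' := fun x y => Subtype.ext (A.map_add x y)
      map_smul' := fun r x => Subtype.ext (A.map_smul r x) }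
  exact ⟨L.mkContinuous c hn, L.mkContinuous_norm_le hc hn, fun v j => rfl⟩

lemma aux_shift {p : ℝ≥0∞} [Fact (1 ≤ p)] {ι κ : Type} {E : ι → Type} {F : κ → Type}
    [∀ j, NormedAddCommGroup (E j)] [∀ j, NormedSpace ℝ (E j)]
    [∀ j, NormedAddCommGroup (F j)] [∀ j, NormedSpace ℝ (F j)]
    (σ : κ → ι) (A : ∀ j, E (σ j) →L[ℝ] F j) (c : ℝ) (hc : 0 ≤ c)
    (hA : ∀ j, ‖A j‖ ≤ c) (hσ : Set.InjOn σ {j | A j ≠ 0}) :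
    ∃ Φ : lp E p →L[ℝ] lp F p, ‖Φ‖ ≤ c ∧
      ∀ (v : lp E p) j, (Φ v : ∀ j, F j) j = A j (v (σ j)) := by
  classical
  let L : lp E p →ₗ[ℝ] (∀ j, F j) :=
    { toFun := fun v j => A j (v (σ j))
      map_add' := fun x y => by ext j; simp
      map_smul' := fun r x => by ext j; simp }
  have hb : ∀ (v : lp E p) j, ‖L v j‖ ≤ c * ‖v (σ j)‖ := fun v j =>
    ((A j).le_opNorm _).trans (mul_le_mul_of_nonneg_right (hA j) (norm_nonneg _))
  refine aux_mk L c hc (fun v => aux_crit _ _ (by positivity) ?_ ?_)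
  · rintro rfl j
    exact (hb v j).trans (mul_le_mul_of_nonneg_left (lp.norm_apply_le_norm (by simp) v _) hc)
  · intro hp hp0 s
    have e1 : ∑ j ∈ s, ‖L v j‖ ^ p.toReal
        = ∑ j ∈ s.filter (fun j => A j ≠ 0), ‖L v j‖ ^ p.toReal := by
      symm
      apply Finset.sum_filter_of_ne
      intro j _ h h0
      apply h
      have : L v j = 0 := by show A j _ = 0; rw [h0]; rfl
      rw [this, norm_zero, Real.zero_rpow hp0.ne']
    rw [e1, Real.mul_rpow hc (norm_nonneg _)]
    calc ∑ j ∈ s.filter (fun j => A j ≠ 0), ‖L v j‖ ^ p.toReal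
        ≤ ∑ j ∈ s.filter (fun j => A j ≠ 0), c ^ p.toReal * ‖v (σ j)‖ ^ p.toReal := by
          apply Finset.sum_le_sum
          intro j _
          rw [← Real.mul_rpow hc (norm_nonneg _)]
          exact Real.rpow_le_rpow (norm_nonneg _) (hb v j) hp0.le
      _ = c ^ p.toReal * ∑ i ∈ (s.filter (fun j => A j ≠ 0)).image σ, ‖v i‖ ^ p.toReal := by
          rw [Finset.sum_image, Finset.mul_sum]
          intro a ha b hb h
          exact hσ (by simpa using (Finset.mem_filter.1 ha).2)
            (by simpa using (Finset.mem_filter.1 hb).2) h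
      _ ≤ _ := mul_le_mul_of_nonneg_left (lp.sum_rpow_le_norm_rpow hp0 v _)
          (Real.rpow_nonneg hc _)

lemma aux_symm {C : ℝ} {X Y : Type} [NormedAddCommGroup X] [NormedSpace ℝ X]
    [NormedAddCommGroup Y] [NormedSpace ℝ Y] (h : IsCIsomorphic C X Y) :
    IsCIsomorphic C Y X := by
  obtain ⟨S, T, h1, h2, h3⟩ := h
  exact ⟨T, S, h2, h1, by rwa [mul_comm]⟩

lemma aux_trans {C D : ℝ} {X Y Z : Type} [NormedAddCommGroup X] [NormedSpace ℝ X]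
    [NormedAddCommGroup Y] [NormedSpace ℝ Y] [NormedAddCommGroup Z] [NormedSpace ℝ Z]
    (h : IsCIsomorphic C X Y) (h' : IsCIsomorphic D Y Z) :
    IsCIsomorphic (C * D) X Z := by
  obtain ⟨S, T, h1, h2, h3⟩ := h
  obtain ⟨S', T', h1', h2', h3'⟩ := h'
  refine ⟨S'.comp S, T.comp T', fun x => by simp [h1, h1'], fun x => by simp [h2, h2'], ?_⟩
  calc ‖S'.comp S‖ * ‖T.comp T'‖ ≤ (‖S'‖ * ‖S‖) * (‖T‖ * ‖T'‖) :=
        mul_le_mul (S'.opNorm_comp_le S) (T.opNorm_comp_le T') (norm_nonneg _) (by positivity)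
    _ = (‖S‖ * ‖T‖) * (‖S'‖ * ‖T'‖) := by ring
    _ ≤ C * D := mul_le_mul h3 h3' (by positivity) ((by positivity : 0 ≤ ‖S‖ * ‖T‖).trans h3)

lemma aux_cast {ι : Type} (E : ι → Type) [∀ j, NormedAddCommGroup (E j)]
    [∀ j, NormedSpace ℝ (E j)] {a b : ι} (h : a = b) :
    ∃ A : E a →L[ℝ] E b, ‖A‖ ≤ 1 ∧ ∀ x : ∀ i, E i, A (x a) = x b := by
  subst h
  exact ⟨ContinuousLinearMap.id ℝ _, ContinuousLinearMap.norm_id_le, fun x => rfl⟩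

lemma aux_reindex {p : ℝ≥0∞} [Fact (1 ≤ p)] {ι κ : Type} (E : ι → Type)
    [∀ j, NormedAddCommGroup (E j)] [∀ j, NormedSpace ℝ (E j)] (e : κ ≃ ι) :
    IsCIsomorphic 1 (lp E p) (lp (fun k => E (e k)) p) := by
  obtain ⟨Φ, hΦ, hΦ'⟩ := aux_shift (p := p) (E := E) (F := fun k => E (e k)) e
    (fun j => ContinuousLinearMap.id ℝ _) 1 zero_le_one
    (fun j => ContinuousLinearMap.norm_id_le) e.injective.injOn
  choose A hA hA' using fun i => aux_cast E (e.apply_symm_apply i)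
  obtain ⟨Ψ, hΨ, hΨ'⟩ := aux_shift (p := p) (E := fun k => E (e k)) (F := E) e.symm
    A 1 zero_le_one hA e.symm.injective.injOn
  have key : ∀ x, Ψ (Φ x) = x := by
    intro x
    ext i
    rw [hΨ', hΦ']
    exact hA' i x
  refine ⟨Φ, Ψ, key, ?_, ?_⟩
  · intro y
    ext k
    rw [hΦ']
    have h2 : ∀ i, ∃ k, e k = i := e.surjective
    have h3 : ∀ i, (Ψ y) i = A i (y (e.symm i)) := hΨ' y
    have := aux_cast (fun k => E (e k)) (e.symm_apply_apply k)
    obtain ⟨B, hB, hB'⟩ := this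
    simp only [ContinuousLinearMap.id_apply]
    rw [h3]
    let y' : ∀ i, E i := Equiv.piCongrLeft E e y
    have hy : ∀ k, y' (e k) = y k := fun k => Equiv.piCongrLeft_apply_apply E e y k
    rw [← hy, ← hy]
    exact hA' (e k) y'
  · calc ‖Φ‖ * ‖Ψ‖ ≤ 1 * 1 := mul_le_mul hΦ hΨ (norm_nonneg _) zero_le_one
      _ = 1 := one_mul 1

lemma aux_curry {p : ℝ≥0∞} [Fact (1 ≤ p)] (E : ℕ → Type)
    [∀ j, NormedAddCommGroup (E j)] [∀ j, NormedSpace ℝ (E j)] :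
    IsCIsomorphic 1 (lp (fun q : ℕ × ℕ => E q.2) p) (lp (fun _ : ℕ => lp E p) p) := by
  classical
  -- slices
  have hsl : ∀ a : ℕ, ∃ Φ : lp (fun q : ℕ × ℕ => E q.2) p →L[ℝ] lp E p, ‖Φ‖ ≤ 1 ∧
      ∀ v j, (Φ v : ∀ j, E j) j = ContinuousLinearMap.id ℝ (E j) (v (a, j)) := fun a =>
    aux_shift (p := p) (E := fun q : ℕ × ℕ => E q.2) (F := E) (fun j => (a, j))
      (fun j => ContinuousLinearMap.id ℝ _) 1 zero_le_one
      (fun j => ContinuousLinearMap.norm_id_le)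
      (fun x _ y _ h => (Prod.mk.inj h).2)
  choose P hP hP' using hsl
  let L : lp (fun q : ℕ × ℕ => E q.2) p →ₗ[ℝ] (∀ _ : ℕ, lp E p) :=
    { toFun := fun v a => P a v
      map_add' := fun x y => by ext a : 1; simp
      map_smul' := fun r x => by ext a : 1; simp }
  obtain ⟨Φ, hΦ, hΦ'⟩ : ∃ Φ : lp (fun q : ℕ × ℕ => E q.2) p →L[ℝ] lp (fun _ : ℕ => lp E p) p,
      ‖Φ‖ ≤ 1 ∧ ∀ v j, (Φ v : ∀ _ : ℕ, lp E p) j = L v j := by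
    refine aux_mk L 1 zero_le_one (fun v => aux_crit _ _ (by positivity) ?_ ?_)
    · intro _ a
      exact (P a).le_of_opNorm_le (hP a) v
    · intro hp hp0 s
      have hs : HasSum (fun b => ∑ a ∈ s, ‖P a v b‖ ^ p.toReal)
          (∑ a ∈ s, ‖P a v‖ ^ p.toReal) :=
        hasSum_sum (fun a _ => lp.hasSum_norm hp0 (P a v))
      refine hasSum_le_of_sum_le hs (fun t => ?_)
      rw [one_mul, Finset.sum_comm]
      calc ∑ a ∈ s, ∑ b ∈ t, ‖P a v b‖ ^ p.toReal
          = ∑ q ∈ s ×ˢ t, ‖v q‖ ^ p.toReal := by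
            rw [Finset.sum_product]
            refine Finset.sum_congr rfl (fun a _ => Finset.sum_congr rfl (fun b _ => ?_))
            rw [hP']
            rfl
        _ ≤ _ := lp.sum_rpow_le_norm_rpow hp0 v _
  let M : lp (fun _ : ℕ => lp E p) p →ₗ[ℝ] (∀ q : ℕ × ℕ, E q.2) :=
    { toFun := fun x q => x q.1 q.2
      map_add' := fun x y => by ext q; simp
      map_smul' := fun r x => by ext q; simp }
  obtain ⟨Ψ, hΨ, hΨ'⟩ : ∃ Ψ : lp (fun _ : ℕ => lp E p) p →L[ℝ] lp (fun q : ℕ × ℕ => E q.2) p,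
      ‖Ψ‖ ≤ 1 ∧ ∀ v j, (Ψ v : ∀ q : ℕ × ℕ, E q.2) j = M v j := by
    have hp00 : p ≠ 0 := (zero_lt_one.trans_le (Fact.out : 1 ≤ p)).ne'
    refine aux_mk M 1 zero_le_one (fun v => aux_crit _ _ (by positivity) ?_ ?_)
    · intro _ q
      rw [one_mul]
      exact (lp.norm_apply_le_norm hp00 (v q.1) q.2).trans (lp.norm_apply_le_norm hp00 v q.1)
    · intro hp hp0 s
      rw [one_mul]
      calc ∑ q ∈ s, ‖M v q‖ ^ p.toReal
          ≤ ∑ q ∈ (s.image Prod.fst) ×ˢ (s.image Prod.snd), ‖M v q‖ ^ p.toReal :=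
            Finset.sum_le_sum_of_subset_of_nonneg Finset.subset_product
              (fun _ _ _ => by positivity)
        _ = ∑ a ∈ s.image Prod.fst, ∑ b ∈ s.image Prod.snd, ‖v a b‖ ^ p.toReal := by
            rw [Finset.sum_product]
            rfl
        _ ≤ ∑ a ∈ s.image Prod.fst, ‖v a‖ ^ p.toReal :=
            Finset.sum_le_sum (fun a _ => lp.sum_rpow_le_norm_rpow hp0 (v a) _)
        _ ≤ _ := lp.sum_rpow_le_norm_rpow hp0 v _
  refine ⟨Φ, Ψ, ?_, ?_, ?_⟩
  · intro x
    ext q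
    rw [hΨ']
    show (Φ x q.1) q.2 = x q
    rw [hΦ']
    exact hP' q.1 x q.2
  · intro y
    ext a b
    rw [hΦ']
    refine (hP' a (Ψ y) b).trans ?_
    rw [hΨ']
    rfl
  · calc ‖Φ‖ * ‖Ψ‖ ≤ 1 * 1 := mul_le_mul hΦ hΨ (norm_nonneg _) zero_le_one
      _ = 1 := one_mul 1

lemma aux_normalize {K : ℝ} (hK : 1 ≤ K) {X Y : Type} [NormedAddCommGroup X] [NormedSpace ℝ X]
    [NormedAddCommGroup Y] [NormedSpace ℝ Y] (h : IsComplementedIn K X Y) :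
    ∃ (S : X →L[ℝ] Y) (T : Y →L[ℝ] X), (∀ x : X, T (S x) = x) ∧ ‖S‖ ≤ K ∧ ‖T‖ ≤ 1 := by
  obtain ⟨S, T, h1, h2⟩ := h
  by_cases hT : T = 0
  · refine ⟨0, 0, fun x => ?_, by simp; linarith, by simp⟩
    rw [← h1 x, hT]
    simp
  · have hn : 0 < ‖T‖ := norm_pos_iff.2 hT
    refine ⟨‖T‖ • S, ‖T‖⁻¹ • T, fun x => ?_, ?_, ?_⟩
    · simp [h1, hn.ne']
    · rw [norm_smul, norm_norm, mul_comm]; exact h2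
    · rw [norm_smul, norm_inv, norm_norm, inv_mul_cancel₀ hn.ne']

def auxσ (R : Type) : (ℕ × ℕ) ⊕ R → ((ℕ × ℕ) ⊕ R) ⊕ ℕ
  | .inl (n, 0) => .inr n
  | .inl (n, k + 1) => .inl (.inl (n, k))
  | .inr r => .inl (.inr r)

def auxτ (R : Type) : ((ℕ × ℕ) ⊕ R) ⊕ ℕ → (ℕ × ℕ) ⊕ R
  | .inl (.inl (n, k)) => .inl (n, k + 1)
  | .inl (.inr r) => .inr r
  | .inr n => .inl (n, 0)

def auxρ (R : Type) : ((ℕ × ℕ) ⊕ R) ⊕ ℕ → (ℕ × ℕ) ⊕ R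
  | .inl m => m
  | .inr n => .inl (n, 0)

lemma aux_core {p : ℝ≥0∞} [Fact (1 ≤ p)] {K : ℝ} (hK : 1 ≤ K) (R : Type)
    (E : ((ℕ × ℕ) ⊕ R) ⊕ ℕ → Type)
    [∀ j, NormedAddCommGroup (E j)] [∀ j, NormedSpace ℝ (E j)]
    (h : ∀ n k, IsComplementedIn K (E (.inr n)) (E (.inl (.inl (n, k))))) :
    IsCIsomorphic ((1 + 2 * K) * (1 + 2 * K)) (lp (fun m => E (.inl m)) p) (lp E p) := by
  choose S T hTS hS hT using fun n k => aux_normalize hK (h n k)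
  have hST : ∀ n k k', ‖(S n k).comp (T n k')‖ ≤ K := by
    intro n k k'
    refine ((S n k).opNorm_comp_le _).trans ?_
    calc ‖S n k‖ * ‖T n k'‖ ≤ K * 1 :=
          mul_le_mul (hS n k) (hT n k') (norm_nonneg _) (by linarith)
      _ = K := mul_one K
  have hI : ∀ n k, ‖ContinuousLinearMap.id ℝ _ - (S n k).comp (T n k)‖ ≤ 1 + K := fun n k =>
    (norm_sub_le _ _).trans (add_le_add ContinuousLinearMap.norm_id_le (hST n k k))
  have hid : ∀ j, ‖ContinuousLinearMap.id ℝ (E j)‖ ≤ 1 + K := fun j =>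
    ContinuousLinearMap.norm_id_le.trans (by linarith)
  obtain ⟨Φ₁, a1, b1⟩ := aux_shift (p := p) (E := E) (F := fun m => E (.inl m)) Sum.inl
    (fun m => match m with
      | .inl (n, k) => ContinuousLinearMap.id ℝ _ - (S n k).comp (T n k)
      | .inr r => ContinuousLinearMap.id ℝ _) (1 + K) (by linarith)
    (by rintro (⟨n, k⟩ | r)
        · exact hI n k
        · exact hid _) Sum.inl_injective.injOn
  obtain ⟨Φ₂, a2, b2⟩ := aux_shift (p := p) (E := E) (F := fun m => E (.inl m)) (auxσ R)
    (fun m => match m with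
      | .inl (n, 0) => S n 0
      | .inl (n, k + 1) => (S n (k + 1)).comp (T n k)
      | .inr r => 0) K (by linarith)
    (by rintro (⟨n, _ | k⟩ | r)
        · exact hS n 0
        · exact hST n _ _
        · simp; linarith)
    (by
      apply Function.Injective.injOn
      rintro (⟨n, _ | k⟩ | r) (⟨n', _ | k'⟩ | r') h <;> simp [auxσ] at h ⊢ <;> exact h)
  obtain ⟨Ψ₁, a3, b3⟩ := aux_shift (p := p) (E := fun m => E (.inl m)) (F := E) (auxρ R)
    (fun m => match m with
      | .inl (.inl (n, k)) => ContinuousLinearMap.id ℝ _ - (S n k).comp (T n k)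
      | .inl (.inr r) => ContinuousLinearMap.id ℝ _
      | .inr n => 0) (1 + K) (by linarith)
    (by rintro ((⟨n, k⟩ | r) | n)
        · exact hI n k
        · exact hid _
        · simp; linarith)
    (by
      rintro (m | n) h (m' | n') h' hh
      · exact congrArg Sum.inl hh
      · exact absurd rfl h'
      · exact absurd rfl h
      · exact absurd rfl h)
  obtain ⟨Ψ₂, a4, b4⟩ := aux_shift (p := p) (E := fun m => E (.inl m)) (F := E) (auxτ R)
    (fun m => match m with
      | .inl (.inl (n, k)) => (S n k).comp (T n (k + 1))
      | .inl (.inr r) => 0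
      | .inr n => T n 0) K (by linarith)
    (by rintro ((⟨n, k⟩ | r) | n)
        · exact hST n _ _
        · simp; linarith
        · exact (hT n 0).trans hK)
    (by
      apply Function.Injective.injOn
      rintro ((⟨n, k⟩ | r) | n) ((⟨n', k'⟩ | r') | n') h <;> simp [auxτ] at h ⊢ <;> exact h)
  -- coordinates
  have f0 : ∀ (x : lp E p) n, ((Φ₁ + Φ₂) x) (.inl (n, 0))
      = (x (.inl (.inl (n, 0))) - S n 0 (T n 0 (x (.inl (.inl (n, 0)))))) + S n 0 (x (.inr n)) :=
    fun x n => congrArg₂ (· + ·) (b1 x (.inl (n, 0))) (b2 x (.inl (n, 0)))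
  have f1 : ∀ (x : lp E p) n k, ((Φ₁ + Φ₂) x) (.inl (n, k + 1))
      = (x (.inl (.inl (n, k + 1))) - S n (k + 1) (T n (k + 1) (x (.inl (.inl (n, k + 1))))))
        + S n (k + 1) (T n k (x (.inl (.inl (n, k))))) :=
    fun x n k => congrArg₂ (· + ·) (b1 x (.inl (n, k + 1))) (b2 x (.inl (n, k + 1)))
  have f2 : ∀ (x : lp E p) r, ((Φ₁ + Φ₂) x) (.inr r) = x (.inl (.inr r)) :=
    fun x r => (congrArg₂ (· + ·) (b1 x (.inr r)) (b2 x (.inr r))).trans (add_zero _)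
  have g0 : ∀ (y : lp (fun m => E (.inl m)) p) n k, ((Ψ₁ + Ψ₂) y) (.inl (.inl (n, k)))
      = (y (.inl (n, k)) - S n k (T n k (y (.inl (n, k)))))
        + S n k (T n (k + 1) (y (.inl (n, k + 1)))) :=
    fun y n k => congrArg₂ (· + ·) (b3 y (.inl (.inl (n, k)))) (b4 y (.inl (.inl (n, k))))
  have g1 : ∀ (y : lp (fun m => E (.inl m)) p) r, ((Ψ₁ + Ψ₂) y) (.inl (.inr r)) = y (.inr r) :=
    fun y r => (congrArg₂ (· + ·) (b3 y (.inl (.inr r))) (b4 y (.inl (.inr r)))).trans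
      (add_zero _)
  have g2 : ∀ (y : lp (fun m => E (.inl m)) p) n, ((Ψ₁ + Ψ₂) y) (.inr n)
      = T n 0 (y (.inl (n, 0))) :=
    fun y n => (congrArg₂ (· + ·) (b3 y (.inr n)) (b4 y (.inr n))).trans (zero_add _)
  refine ⟨Ψ₁ + Ψ₂, Φ₁ + Φ₂, ?_, ?_, ?_⟩
  · intro y
    ext m
    rcases m with ⟨n, _ | k⟩ | r
    · rw [f0, g0, g2]; simp [hTS]
    · rw [f1, g0, g0]; simp [hTS]
    · rw [f2, g1]
  · intro x
    ext m
    rcases m with (⟨n, _ | k⟩ | r) | n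
    · rw [g0, f0, f1]; simp [hTS]
    · rw [g0, f1, f1]; simp [hTS]
    · rw [g1, f2]
    · rw [g2, f0]; simp [hTS]
  · refine mul_le_mul ((norm_add_le _ _).trans ?_) ((norm_add_le _ _).trans ?_)
      (norm_nonneg _) (by linarith) <;> linarith

lemma aux_inj {J : Type} [PartialOrder J] (φ ψ : ℕ → J)
    (hψ : ∀ (j : J) (m : ℕ), ∃ n : ℕ, m ≤ n ∧ j ≤ ψ n) :
    ∃ f : ℕ × ℕ → ℕ, Function.Injective f ∧ ∀ q, φ q.1 ≤ ψ (f q) := by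
  choose g hg hg' using hψ
  let F : ℕ → ℕ := fun t => Nat.rec (g (φ (Nat.unpair 0).1) 0)
    (fun t r => g (φ (Nat.unpair (t + 1)).1) (r + 1)) t
  have hF : StrictMono F := strictMono_nat_of_lt_succ (fun t => hg _ (F t + 1))
  have hF' : ∀ t, φ (Nat.unpair t).1 ≤ ψ (F t) := by
    rintro (_ | t)
    · exact hg' _ _
    · exact hg' _ _
  refine ⟨fun q => F (Nat.pair q.1 q.2), fun a b h => ?_, fun q => ?_⟩
  · have := Nat.pair_eq_pair.1 (hF.injective h)
    exact Prod.ext this.1 this.2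
  · have := hF' (Nat.pair q.1 q.2)
    rwa [Nat.unpair_pair] at this

lemma aux_half {p : ℝ≥0∞} [Fact (1 ≤ p)] {K : ℝ} (hK : 1 ≤ K) {J : Type} [PartialOrder J]
    (X : J → Type) [∀ j, NormedAddCommGroup (X j)] [∀ j, NormedSpace ℝ (X j)]
    (hX : ∀ i j : J, i ≤ j → IsComplementedIn K (X i) (X j)) (φ ψ : ℕ → J)
    (hψ : ∀ (j : J) (m : ℕ), ∃ n : ℕ, m ≤ n ∧ j ≤ ψ n) :
    IsCIsomorphic ((1 + 2 * K) * (1 + 2 * K)) (lp (fun n => X (ψ n)) p)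
      (lp (fun i : ℕ ⊕ ℕ => X (Sum.elim ψ φ i)) p) := by
  classical
  obtain ⟨f, hf, hf'⟩ := aux_inj φ ψ hψ
  let e : (ℕ × ℕ) ⊕ ((Set.range f)ᶜ : Set ℕ) ≃ ℕ :=
    (Equiv.sumCongr (Equiv.ofInjective f hf) (Equiv.refl _)).trans (Equiv.Set.sumCompl _)
  have he : ∀ q, e (.inl q) = f q := fun q => rfl
  let e' := Equiv.sumCongr e (Equiv.refl ℕ)
  have h1 := aux_reindex (p := p) (fun n => X (ψ n)) e
  have h3 := aux_reindex (p := p) (fun i : ℕ ⊕ ℕ => X (Sum.elim ψ φ i)) e'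
  have h2 := aux_core (p := p) hK _ (fun i => X (Sum.elim ψ φ (e' i)))
    (fun n k => hX _ _ (hf' (n, k)))
  have := aux_trans (aux_trans h1 h2) (aux_symm h3)
  rwa [one_mul, mul_one] at this

lemma aux_main {p : ℝ≥0∞} [Fact (1 ≤ p)] {K : ℝ} (hK : 1 ≤ K) {J : Type} [PartialOrder J]
    (X : J → Type) [∀ j, NormedAddCommGroup (X j)] [∀ j, NormedSpace ℝ (X j)]
    (hX : ∀ i j : J, i ≤ j → IsComplementedIn K (X i) (X j)) (φ ψ : ℕ → J)
    (hφ : ∀ (j : J) (m : ℕ), ∃ n : ℕ, m ≤ n ∧ j ≤ φ n)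
    (hψ : ∀ (j : J) (m : ℕ), ∃ n : ℕ, m ≤ n ∧ j ≤ ψ n) :
    IsCIsomorphic ((1 + 2 * K) ^ 4) (lp (fun n => X (φ n)) p) (lp (fun n => X (ψ n)) p) := by
  have h1 := aux_half (p := p) hK X hX ψ φ hφ
  have h2 := aux_half (p := p) hK X hX φ ψ hψ
  have h3 := aux_reindex (p := p) (fun i : ℕ ⊕ ℕ => X (Sum.elim φ ψ i)) (Equiv.sumComm ℕ ℕ)
  have e : Sum.elim ψ φ = fun i => Sum.elim φ ψ (Equiv.sumComm ℕ ℕ i) := by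
    ext (i | i) <;> rfl
  rw [e] at h2
  have := aux_trans (aux_trans h1 h3) (aux_symm h2)
  convert this using 1
  ring

/-- **A Pełczyński-type decomposition lemma for `ℓ_p`-sums.**
For every `K ≥ 1` and `1 ≤ p ≤ ∞` there is a constant `C ≥ 1`, depending only on `K` and `p`,
such that: whenever `(X_j)_{j ∈ J}` is a family of Banach spaces indexed by a partially ordered
set `J` with `X_i` `K`-complemented in `X_j` for `i ≤ j`, and `φ₁, φ₂ : ℕ → J` are maps such that
for every `j ∈ J` and `m ∈ ℕ` there is `n ≥ m` with `j ≤ φᵢ(n)`, then, setting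
`Y_i = (⊕ₙ X_{φᵢ(n)})_p`, the spaces `Y₁` and `Y₂` are `C`-isomorphic and `Y₁` is `C`-isomorphic
to `(⊕ₙ Y₁)_p`. -/
theorem stmt9 (K : ℝ) (hK : 1 ≤ K) (p : ℝ≥0∞) [Fact (1 ≤ p)] :
    ∃ C : ℝ, 1 ≤ C ∧
      ∀ (J : Type) (_ : PartialOrder J) (X : J → Type)
        (_ : ∀ j, NormedAddCommGroup (X j)) (_ : ∀ j, NormedSpace ℝ (X j))
        (_ : ∀ j, CompleteSpace (X j)),
        (∀ i j : J, i ≤ j → IsComplementedIn K (X i) (X j)) →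
        ∀ φ₁ φ₂ : ℕ → J,
          (∀ (j : J) (m : ℕ), ∃ n : ℕ, m ≤ n ∧ j ≤ φ₁ n) →
          (∀ (j : J) (m : ℕ), ∃ n : ℕ, m ≤ n ∧ j ≤ φ₂ n) →
          IsCIsomorphic C (lp (fun n : ℕ => X (φ₁ n)) p) (lp (fun n : ℕ => X (φ₂ n)) p) ∧
          IsCIsomorphic C (lp (fun n : ℕ => X (φ₁ n)) p)
            (lp (fun _ : ℕ => lp (fun n : ℕ => X (φ₁ n)) p) p) := by
  refine ⟨(1 + 2 * K) ^ 4, one_le_pow₀ (by linarith), ?_⟩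
  intro J _ X _ _ _ hX φ₁ φ₂ h₁ h₂
  refine ⟨aux_main hK X hX φ₁ φ₂ h₁ h₂, ?_⟩
  have h3 := aux_main (p := p) hK X hX φ₁ (fun n => φ₁ (Nat.unpair n).2) h₁ (fun j m => by
    obtain ⟨n, _, hn⟩ := h₁ j 0
    exact ⟨Nat.pair m n, Nat.left_le_pair m n, by simpa using hn⟩)
  have h4 := aux_reindex (p := p) (fun q : ℕ × ℕ => X (φ₁ q.2)) Nat.pairEquiv.symm
  have h5 := aux_curry (p := p) (fun n => X (φ₁ n))
  have := aux_trans (aux_trans h3 (aux_symm h4)) h5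
  rwa [mul_one, mul_one] at this
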